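/- arXiv:2507.18779 — 2 statements merged into one kernel-verified Lean document; each statement's English description precedes it below -/
import Mathlib

section
/- Let d ≥ 3 be an integer and β ≥ 8 a real number. Then the topological entropy h of the d-ary β-free shift X^d_β satisfies e^{4h} ≥ d³ − 1, i.e., h ≥ (1/4) log(d³ − 1). In particular h > 0. -/
open MeasureTheory Filter Real Set

/-- The left shift on bi-infinite sequences. -/
def shift {A : Type*} (x : ℤ → A) : ℤ → A := fun n => x (n + 1)

/-- `w` occurs as a factor (finite subword) of the bi-infinite sequence `x`. -/
def FactorOf {A : Type*} (w : List A) (x : ℤ → A) : Prop :=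
  ∃ i : ℤ, ∀ t : ℕ, (ht : t < w.length) → x (i + t) = w[t]

/-- `ℓ` is a period of the word `w`. -/
def HasPeriodN {A : Type*} (w : List A) (ℓ : ℕ) : Prop :=
  1 ≤ ℓ ∧ ℓ ≤ w.length ∧ ∀ t : ℕ, (ht : t + ℓ < w.length) →
    w[t]'(lt_of_le_of_lt (Nat.le_add_right t ℓ) ht) = w[t + ℓ]

/-- The `d`-ary `β`-free shift. -/
def betaFree (d : ℕ) (β : ℝ) : Set (ℤ → Fin d) :=
  {x | ∀ w : List (Fin d), FactorOf w x → ∀ ℓ : ℕ, HasPeriodN w ℓ → (w.length : ℝ) < β * ℓ}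

/-- The language of a shift space. -/
def language {A : Type*} (X : Set (ℤ → A)) : Set (List A) :=
  {w | ∃ x ∈ X, FactorOf w x}

/-- The words of length `n` in the language of `X`. -/
def langN {A : Type*} (X : Set (ℤ → A)) (n : ℕ) : Set (List A) :=
  {w | w ∈ language X ∧ w.length = n}

/-- The cylinder of a word. -/
def cylinder {A : Type*} (w : List A) : Set (ℤ → A) :=
  {x | ∀ t : ℕ, (ht : t < w.length) → x (t : ℤ) = w[t]}

/-- A shift space: closed and shift-invariant. -/
def IsShiftSpace {A : Type*} [TopologicalSpace A] (X : Set (ℤ → A)) : Prop :=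
  IsClosed X ∧ shift '' X = X

/-- Invariance of a measure under the shift. -/
def IsShiftInvariant {A : Type*} [MeasurableSpace A] (μ : Measure (ℤ → A)) : Prop :=
  ∀ E : Set (ℤ → A), MeasurableSet E → μ (shift ⁻¹' E) = μ E

/-- The `n`-th partition sum `H_n(μ) = Σ_w −μ[w] log μ[w]`. -/
noncomputable def cylEntropySum {A : Type*} [Fintype A] [MeasurableSpace A]
    (μ : Measure (ℤ → A)) (n : ℕ) : ℝ :=
  ∑ w : Fin n → A, Real.negMulLog (μ (cylinder (List.ofFn w))).toReal

/-- `μ` is a measure of maximal entropy on `X` (with topological entropy `h`). -/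
def IsMME {A : Type*} [Fintype A] [MeasurableSpace A]
    (X : Set (ℤ → A)) (h : ℝ) (μ : Measure (ℤ → A)) : Prop :=
  IsProbabilityMeasure μ ∧ μ X = 1 ∧ IsShiftInvariant μ ∧
    Tendsto (fun n : ℕ => cylEntropySum μ n / n) atTop (nhds h)

/-- A word is a 4-power. -/
def IsFourPower {A : Type*} (s : List A) : Prop :=
  ∃ v : List A, v ≠ [] ∧ s = v ++ v ++ v ++ v

/-- Good words: words of the language no prefix or suffix of which is a 4-power. -/
def goodWords {A : Type*} (X : Set (ℤ → A)) : Set (List A) :=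
  {w | w ∈ language X ∧ (∀ p : List A, p <+: w → ¬ IsFourPower p) ∧
       (∀ s : List A, s <:+ w → ¬ IsFourPower s)}

/-- Words of the language that are concatenations of 4-powers of words of the language. -/
def fourPowerConcat {A : Type*} (X : Set (ℤ → A)) : Set (List A) :=
  {w | w ∈ language X ∧ ∃ ps : List (List A),
      (∀ p ∈ ps, ∃ v ∈ language X, v ≠ [] ∧ p = v ++ v ++ v ++ v) ∧ w = ps.flatten}

/-- Alternating concatenation `w₁u₁w₂u₂⋯`. -/
def alternate {A : Type*} : List (List A) → List (List A) → List A
  | [], _ => []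
  | w :: _, [] => w
  | w :: ws, u :: us => w ++ u ++ alternate ws us

/-- The map deleting the first `i` and the last `k` symbols of a word. -/
def phi {A : Type*} (i k : ℕ) (w : List A) : List A := (w.drop i).take (w.length - i - k)

/-- Maximal `k` such that the first `k` symbols of `w` follow the periodic
pattern of period `ℓ` determined by the prefix of `w` of length `ℓ`. -/
noncomputable def preK {A : Type*} (w : List A) (ℓ : ℕ) : ℕ :=
  sSup {k | k ≤ w.length ∧ ∀ t < k, w[t]? = w[t % ℓ]?}

/-- `pre_ℓ(w)`: the number of times the length-`ℓ` prefix of `w` repeats at the start of `w`. -/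
noncomputable def pre {A : Type*} (w : List A) (ℓ : ℕ) : ℝ := (preK w ℓ : ℝ) / ℓ

/-- `suf_ℓ(w)`: the number of times the length-`ℓ` suffix of `w` repeats at the end of `w`. -/
noncomputable def suf {A : Type*} (w : List A) (ℓ : ℕ) : ℝ := pre w.reverse ℓ

/-- An eighth power of a word of length `ℓ` starts at position `i` of `w`. -/
def EighthPowerAt {A : Type*} (w : List A) (i ℓ : ℕ) : Prop :=
  1 ≤ ℓ ∧ i + 8 * ℓ ≤ w.length ∧ ∀ t < 7 * ℓ, w[i + t]? = w[i + t + ℓ]?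

/-- The finite word `w` contains no eighth power. -/
def EighthPowerFree {A : Type*} (w : List A) : Prop :=
  ∀ i ℓ, ¬ EighthPowerAt w i ℓ

/-- The eighth-power-free words of length `n`. -/
def freeWords (A : Type*) (n : ℕ) : Set (List A) :=
  {w | w.length = n ∧ EighthPowerFree w}

/-- An eighth power of a word of length `ℓ` starts at position `i` of the sequence `x`. -/
def SeqEighthPowerAt {A : Type*} (x : ℤ → A) (i : ℤ) (ℓ : ℕ) : Prop :=
  1 ≤ ℓ ∧ ∀ t : ℕ, t < 7 * ℓ → x (i + t) = x (i + t + ℓ)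

/-- `w` extends to an eighth-power-free word by at least `m` letters on each side. -/
def Extendable {A : Type*} (m : ℕ) (w : List A) : Prop :=
  ∃ u v : List A, m ≤ u.length ∧ m ≤ v.length ∧ EighthPowerFree (u ++ w ++ v)

/-- Words of length `N` that extend to the left by at least `m` letters to an
eighth-power-free word. -/
def leftExtendable (A : Type*) (m N : ℕ) : Set (List A) :=
  {v | v.length = N ∧ ∃ u : List A, m ≤ u.length ∧ EighthPowerFree (u ++ v)}

section Words

variable {A : Type*}

theorem EighthPowerFree.of_append {a b c : List A} (h : EighthPowerFree (a ++ b ++ c)) :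
    EighthPowerFree b := by
  rintro i ℓ ⟨h1, h2, h3⟩
  have key : ∀ j < b.length, (a ++ b ++ c)[a.length + j]? = b[j]? := by
    intro j hj
    rw [List.getElem?_append_left (by simp; omega), List.getElem?_append_right (by omega)]
    simp
  refine h (a.length + i) ℓ ⟨h1, by simp; omega, fun t ht => ?_⟩
  have e1 := key (i + t) (by omega)
  have e2 := key (i + t + ℓ) (by omega)
  have e3 := h3 t ht
  simp only [← add_assoc] at e1 e2
  rw [e1, e2, e3]

theorem EighthPowerFree.drop {w : List A} (h : EighthPowerFree w) (i : ℕ) :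
    EighthPowerFree (w.drop i) := by
  apply EighthPowerFree.of_append (a := w.take i) (c := [])
  simpa using h

theorem eighthPowerFree_nil : EighthPowerFree ([] : List A) := by
  rintro i ℓ ⟨h1, h2, -⟩
  simp at h2
  omega

/-- If `w` is eighth-power-free, any eighth power in `a :: w` is a prefix. -/
theorem EighthPowerFree.cons {a : A} {w : List A} (h : EighthPowerFree w)
    (h0 : ∀ ℓ, ¬ EighthPowerAt (a :: w) 0 ℓ) : EighthPowerFree (a :: w) := by
  intro i ℓ hp
  cases i with
  | zero => exact h0 ℓ hp
  | succ i =>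
    obtain ⟨h1, h2, h3⟩ := hp
    refine h i ℓ ⟨h1, by simp at h2; omega, fun t ht => ?_⟩
    have := h3 t ht
    rwa [show i + 1 + t = (i + t) + 1 by ring, show i + t + 1 + ℓ = (i + t + ℓ) + 1 by ring,
      List.getElem?_cons_succ, List.getElem?_cons_succ] at this

/-- A word starting with an eighth power of period `ℓ` is determined by what is left after
removing the first seven periods. -/
theorem EighthPowerAt.eq_of_drop_eq {v w : List A} {ℓ : ℕ} (hv : EighthPowerAt v 0 ℓ)
    (hw : EighthPowerAt w 0 ℓ) (h : v.drop (7 * ℓ) = w.drop (7 * ℓ)) : v = w := by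
  obtain ⟨h1, -, h3⟩ := hv
  obtain ⟨-, -, k3⟩ := hw
  have key : ∀ k i, 7 * ℓ ≤ i + k → v[i]? = w[i]? := by
    intro k
    induction k with
    | zero =>
      intro i hi
      have := congrArg (fun l => l[i - 7 * ℓ]?) h
      simpa [List.getElem?_drop, Nat.add_sub_cancel' (show 7 * ℓ ≤ i from hi)] using this
    | succ k ih =>
      intro i hi
      by_cases hi' : i < 7 * ℓ
      · have e1 := h3 i hi'
        have e2 := k3 i hi'
        rw [zero_add] at e1 e2
        rw [e1, e2]
        exact ih _ (by omega)
      · exact ih i (by omega)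
  exact List.ext_getElem? fun i => key (7 * ℓ) i (by omega)

variable [Finite A]

theorem finite_freeWords (n : ℕ) : (freeWords A n).Finite :=
  (List.finite_length_eq A n).subset fun _ h => h.1

theorem finite_leftExtendable (m N : ℕ) : (leftExtendable A m N).Finite :=
  (List.finite_length_eq A N).subset fun _ h => h.1

theorem finite_langN (X : Set (ℤ → A)) (n : ℕ) : (langN X n).Finite :=
  (List.finite_length_eq A n).subset fun _ h => h.2

theorem card_mul_ncard_freeWords_le (n : ℕ) :
    Nat.card A * (freeWords A n).ncard ≤ (freeWords A (n + 1)).ncard +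
      ∑ j ∈ Finset.range ((n + 1) / 8), (freeWords A (n + 1 - 7 * (j + 1))).ncard := by
  let B : ℕ → Set (List A) := fun j =>
    {v | v.length = n + 1 ∧ EighthPowerFree v.tail ∧ EighthPowerAt v 0 (j + 1)}
  have hBfin : ∀ j, (B j).Finite := fun j =>
    (List.finite_length_eq A (n + 1)).subset fun _ h => h.1
  have hB : ∀ j, (B j).ncard ≤ (freeWords A (n + 1 - 7 * (j + 1))).ncard := by
    intro j
    refine Set.ncard_le_ncard_of_injOn (fun v => v.drop (7 * (j + 1))) ?_ ?_
      (finite_freeWords _)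
    · rintro v ⟨h1, h2, -⟩
      refine ⟨by simp [h1], ?_⟩
      have := h2.drop (7 * j + 6)
      rwa [List.drop_tail] at this
    · rintro v ⟨-, -, hv⟩ w ⟨-, -, hw⟩ h
      exact hv.eq_of_drop_eq hw h
  have hcover : ((Set.univ : Set A) ×ˢ freeWords A n).ncard ≤
      (freeWords A (n + 1) ∪ ⋃ j ∈ Finset.range ((n + 1) / 8), B j).ncard := by
    refine Set.ncard_le_ncard_of_injOn (fun p : A × List A => p.1 :: p.2) ?_ ?_ ?_
    · rintro ⟨a, w⟩ ⟨-, hw⟩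
      by_cases h0 : ∃ ℓ, EighthPowerAt (a :: w) 0 ℓ
      · right
        obtain ⟨ℓ, hℓ⟩ := h0
        have h1 := hℓ.1
        have h2 := hℓ.2.1
        have h3 : w.length = n := hw.1
        simp only [List.length_cons] at h2
        obtain ⟨j, rfl⟩ : ∃ j, ℓ = j + 1 := ⟨ℓ - 1, by omega⟩
        simp only [Set.mem_iUnion]
        exact ⟨j, by rw [Finset.mem_range]; omega, by simp [h3], hw.2, hℓ⟩
      · left
        exact ⟨by simp [hw.1], hw.2.cons (by simpa using h0)⟩
    · rintro ⟨a, w⟩ - ⟨b, v⟩ - h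
      simpa using h
    · exact (finite_freeWords _).union
        ((Finset.finite_toSet _).biUnion fun j _ => hBfin j)
  rw [Set.ncard_prod, Set.ncard_univ] at hcover
  refine hcover.trans ((Set.ncard_union_le _ _).trans ?_)
  gcongr
  exact (Finset.set_ncard_biUnion_le _ _).trans (Finset.sum_le_sum fun j _ => hB j)

end Words

/-- A sequence satisfying the inequality of `card_mul_ncard_freeWords_le` grows by a factor of at
least `d - 1/2` at each step. -/
theorem sub_half_mul_le_of_recurrence {f : ℕ → ℝ} {d : ℝ} (hd : 5 / 2 ≤ d) (hf : ∀ n, 0 ≤ f n)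
    (hrec : ∀ n, d * f n ≤ f (n + 1) +
      ∑ j ∈ Finset.range ((n + 1) / 8), f (n + 1 - 7 * (j + 1))) (n : ℕ) :
    (d - 1 / 2) * f n ≤ f (n + 1) := by
  induction n using Nat.strong_induction_on with
  | _ n ih =>
    have hdouble : ∀ k ≤ n, 2 ^ k * f (n - k) ≤ f n := by
      intro k
      induction k with
      | zero => simp
      | succ k ihk =>
        intro hk
        have h1 := ih (n - (k + 1)) (by omega)
        rw [show n - (k + 1) + 1 = n - k by omega] at h1
        have h2 : 2 * f (n - (k + 1)) ≤ f (n - k) := by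
          nlinarith [hf (n - (k + 1))]
        calc (2 : ℝ) ^ (k + 1) * f (n - (k + 1)) = 2 ^ k * (2 * f (n - (k + 1))) := by ring
          _ ≤ 2 ^ k * f (n - k) := by gcongr
          _ ≤ f n := ihk (by omega)
    have hterm : ∀ j ∈ Finset.range ((n + 1) / 8),
        f (n + 1 - 7 * (j + 1)) ≤ f n / 4 * (1 / 2) ^ j := by
      intro j hj
      rw [Finset.mem_range] at hj
      have h1 := hdouble (7 * j + 6) (by omega)
      rw [show n - (7 * j + 6) = n + 1 - 7 * (j + 1) by omega] at h1
      have h2 : (2 : ℝ) ^ (j + 2) ≤ 2 ^ (7 * j + 6) :=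
        pow_le_pow_right₀ (by norm_num) (by omega)
      have h3 := (mul_le_mul_of_nonneg_right h2 (hf (n + 1 - 7 * (j + 1)))).trans h1
      rw [one_div, inv_pow, ← div_eq_mul_inv, div_div, le_div_iff₀ (by positivity)]
      calc _ = 2 ^ (j + 2) * f (n + 1 - 7 * (j + 1)) := by ring
        _ ≤ f n := h3
    have hsum : ∑ j ∈ Finset.range ((n + 1) / 8), f (n + 1 - 7 * (j + 1)) ≤ f n / 2 := by
      refine (Finset.sum_le_sum hterm).trans ?_
      rw [← Finset.mul_sum]
      have := sum_geometric_two_le ((n + 1) / 8)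
      nlinarith [hf n]
    linarith [hrec n]

theorem pow_le_ncard_freeWords {d : ℕ} (hd : 3 ≤ d) (n : ℕ) :
    ((d : ℝ) - 1 / 2) ^ n ≤ (freeWords (Fin d) n).ncard := by
  have hd' : (3 : ℝ) ≤ d := by exact_mod_cast hd
  induction n with
  | zero =>
    have : (freeWords (Fin d) 0) = {[]} := by
      ext w
      simp only [freeWords, Set.mem_ofPred_eq, List.length_eq_zero_iff, Set.mem_singleton_iff]
      exact ⟨fun h => h.1, fun h => ⟨h, h ▸ eighthPowerFree_nil⟩⟩
    simp [this]
  | succ n ih =>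
    have h := sub_half_mul_le_of_recurrence (f := fun n => ((freeWords (Fin d) n).ncard : ℝ))
      (d := d) (by linarith) (fun n => by positivity) (fun n => by
        have := card_mul_ncard_freeWords_le (A := Fin d) n
        rw [Nat.card_fin] at this
        exact_mod_cast this) n
    rw [pow_succ']
    exact (mul_le_mul_of_nonneg_left ih (by linarith)).trans h

section Compactness

variable {d : ℕ} {β : ℝ}

theorem mem_betaFree_of_forall_not_seqEighthPowerAt (hβ : 8 ≤ β) {x : ℤ → Fin d}
    (hx : ∀ i ℓ, ¬ SeqEighthPowerAt x i ℓ) : x ∈ betaFree d β := by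
  rintro w ⟨i, hi⟩ ℓ ⟨h1, -, h3⟩
  by_contra! hlen
  have h8 : 8 * ℓ ≤ w.length := by
    have : (8 : ℝ) * ℓ ≤ w.length := (by gcongr : (8 : ℝ) * ℓ ≤ β * ℓ).trans hlen
    exact_mod_cast this
  refine hx i ℓ ⟨h1, fun t ht => ?_⟩
  have e := hi (t + ℓ) (by omega)
  rw [hi t (by omega), h3 t (by omega), ← e]
  push_cast
  rw [add_assoc]

theorem isClosed_setOf_not_seqEighthPowerAt (i : ℤ) (ℓ : ℕ) :
    IsClosed {x : ℤ → Fin d | ¬ SeqEighthPowerAt x i ℓ} := by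
  rw [← isOpen_compl_iff]
  have : {x : ℤ → Fin d | ¬ SeqEighthPowerAt x i ℓ}ᶜ = {_x : ℤ → Fin d | 1 ≤ ℓ} ∩
      ⋂ t ∈ Finset.range (7 * ℓ), {x : ℤ → Fin d | x (i + t) = x (i + t + ℓ)} := by
    ext x
    simp [SeqEighthPowerAt]
  rw [this]
  refine isOpen_const.inter (isOpen_biInter_finset fun t _ => ?_)
  have hc : Continuous fun x : ℤ → Fin d => (x (i + t), x (i + t + ℓ)) := by fun_prop
  exact (isOpen_discrete {p : Fin d × Fin d | p.1 = p.2}).preimage hc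

theorem Extendable.exists_seq [NeZero d] {m : ℕ} {w : List (Fin d)} (h : Extendable m w) :
    ∃ x : ℤ → Fin d, (∀ t : ℕ, (ht : t < w.length) → x t = w[t]) ∧
      ∀ (i : ℤ) (ℓ : ℕ), -(m : ℤ) ≤ i → i + 8 * ℓ ≤ w.length + m →
        ¬ SeqEighthPowerAt x i ℓ := by
  obtain ⟨u, v, hu, hv, hfree⟩ := h
  refine ⟨fun j => (u ++ w ++ v)[(j + u.length).toNat]?.getD 0, fun t ht => ?_, ?_⟩
  · have : ((t : ℤ) + u.length).toNat = u.length + t := by omega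
    simp only [this, List.append_assoc]
    rw [List.getElem?_append_right (by omega), List.getElem?_append_left (by omega)]
    simp [ht]
  · rintro i ℓ hi hi' ⟨h1, h2⟩
    refine hfree (i + u.length).toNat ℓ ⟨h1, by simp; omega, fun t ht => ?_⟩
    have e := h2 t ht
    simp only at e
    rw [show (i + t + u.length).toNat = (i + u.length).toNat + t by omega,
      show (i + t + ℓ + u.length).toNat = (i + u.length).toNat + t + ℓ by omega] at e
    have l1 : (i + u.length).toNat + t < (u ++ w ++ v).length := by simp; omega
    have l2 : (i + u.length).toNat + t + ℓ < (u ++ w ++ v).length := by simp; omega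
    rw [List.getElem?_eq_getElem l1, List.getElem?_eq_getElem l2] at e ⊢
    simpa using e

theorem mem_language_of_forall_extendable [NeZero d] (hβ : 8 ≤ β) {w : List (Fin d)}
    (h : ∀ m, Extendable m w) : w ∈ language (betaFree d β) := by
  let K : ℕ → Set (ℤ → Fin d) := fun m =>
    (⋂ t : ℕ, ⋂ ht : t < w.length, {x | x t = w[t]}) ∩
      ⋂ (i : ℤ) (ℓ : ℕ) (_ : -(m : ℤ) ≤ i) (_ : i + 8 * ℓ ≤ w.length + m),
        {x | ¬ SeqEighthPowerAt x i ℓ}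
  have hmem : ∀ m x, x ∈ K m ↔ (∀ t : ℕ, (ht : t < w.length) → x t = w[t]) ∧
      ∀ (i : ℤ) (ℓ : ℕ), -(m : ℤ) ≤ i → i + 8 * ℓ ≤ w.length + m →
        ¬ SeqEighthPowerAt x i ℓ := by
    intro m x
    simp [K]
  have hclosed : ∀ m, IsClosed (K m) := fun m =>
    (isClosed_iInter fun t => isClosed_iInter fun _ =>
      isClosed_eq (continuous_apply _) continuous_const).inter
    (isClosed_iInter fun i => isClosed_iInter fun ℓ => isClosed_iInter fun _ =>
      isClosed_iInter fun _ => isClosed_setOf_not_seqEighthPowerAt i ℓ)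
  obtain ⟨x, hx⟩ := IsCompact.nonempty_iInter_of_sequence_nonempty_isCompact_isClosed K
    (fun m x hx => by
      rw [hmem] at hx ⊢
      exact ⟨hx.1, fun i ℓ h1 h2 => hx.2 i ℓ (by push_cast; omega) (by push_cast; omega)⟩)
    (fun m => by
      obtain ⟨x, hx⟩ := (h m).exists_seq
      exact ⟨x, (hmem m x).2 hx⟩)
    (hclosed 0).isCompact hclosed
  simp only [Set.mem_iInter, hmem] at hx
  refine ⟨x, mem_betaFree_of_forall_not_seqEighthPowerAt hβ fun i ℓ => ?_, 0, fun t ht => ?_⟩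
  · exact (hx (i.natAbs + 8 * ℓ)).2 i ℓ (by omega) (by omega)
  · rw [zero_add]
    exact (hx 0).1 t ht

/-- For words of a fixed length, extendability by sufficiently many letters is enough to belong
to the language of the shift. -/
theorem exists_forall_extendable_mem_langN [NeZero d] (hβ : 8 ≤ β) (n : ℕ) :
    ∃ m, ∀ w : List (Fin d), w.length = n → Extendable m w → w ∈ langN (betaFree d β) n := by
  have h : ∀ w : List (Fin d), ∃ m, Extendable m w → w ∈ language (betaFree d β) := by
    intro w
    by_contra! hw
    exact (hw 0).2 (mem_language_of_forall_extendable hβ fun m => (hw m).1)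
  choose M hM using h
  obtain ⟨m, hm⟩ := ((List.finite_length_eq (Fin d) n).image M).bddAbove
  refine ⟨m, fun w hw ⟨u, v, hu, hv, hf⟩ => ⟨hM w ⟨u, v, ?_, ?_, hf⟩, hw⟩⟩
  all_goals exact (hm ⟨w, hw, rfl⟩).trans ‹_›

theorem ncard_leftExtendable_le {m n : ℕ}
    (hm : ∀ w : List (Fin d), w.length = n → Extendable m w → w ∈ langN (betaFree d β) n)
    (k : ℕ) : (leftExtendable (Fin d) m (k * n + m)).ncard ≤
      (langN (betaFree d β) n).ncard ^ k * (leftExtendable (Fin d) m m).ncard := by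
  induction k with
  | zero => simp
  | succ k ih =>
    have hstep : (leftExtendable (Fin d) m ((k + 1) * n + m)).ncard ≤
        (langN (betaFree d β) n ×ˢ leftExtendable (Fin d) m (k * n + m)).ncard := by
      refine Set.ncard_le_ncard_of_injOn (fun v => (v.take n, v.drop n)) ?_ ?_
        ((finite_langN _ _).prod (finite_leftExtendable _ _))
      · rintro v ⟨hlen, u, hu, hf⟩
        rw [add_mul, one_mul] at hlen
        refine ⟨hm _ (by simp; omega) ⟨u, v.drop n, hu, by simp; omega, ?_⟩,
          by simp; omega, u ++ v.take n, by simp; omega, ?_⟩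
        all_goals simpa [List.append_assoc] using hf
      · rintro v - w - h
        rw [Prod.mk.injEq] at h
        rw [← List.take_append_drop n v, ← List.take_append_drop n w, h.1, h.2]
    rw [Set.ncard_prod] at hstep
    calc _ ≤ _ := hstep
      _ ≤ (langN (betaFree d β) n).ncard * _ := Nat.mul_le_mul_left _ ih
      _ = _ := by ring

theorem ncard_freeWords_le (A : Type*) [Finite A] (m N : ℕ) :
    (freeWords A (m + N)).ncard ≤
      {u : List A | u.length = m}.ncard * (leftExtendable A m N).ncard := by
  rw [← Set.ncard_prod]
  refine Set.ncard_le_ncard_of_injOn (fun v => (v.take m, v.drop m)) ?_ ?_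
    ((List.finite_length_eq A m).prod (finite_leftExtendable _ _))
  · rintro v ⟨hlen, hf⟩
    exact ⟨by simp; omega, by simp; omega, v.take m, by simp; omega, by simpa using hf⟩
  · rintro v - w - h
    rw [Prod.mk.injEq] at h
    rw [← List.take_append_drop m v, ← List.take_append_drop m w, h.1, h.2]

end Compactness

theorem le_of_forall_pow_le_mul_pow {a b C : ℝ} (hb : 0 ≤ b)
    (h : ∀ k : ℕ, a ^ k ≤ C * b ^ k) : a ≤ b := by
  by_contra! hab
  rcases hb.eq_or_lt with rfl | hb
  · have := h 1
    simp at this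
    linarith
  · obtain ⟨k, hk⟩ := pow_unbounded_of_one_lt C ((one_lt_div hb).2 hab)
    rw [div_pow, lt_div_iff₀ (by positivity)] at hk
    exact (h k).not_gt hk

theorem pow_le_ncard_langN {d : ℕ} (hd : 3 ≤ d) {β : ℝ} (hβ : 8 ≤ β) (n : ℕ) :
    ((d : ℝ) - 1 / 2) ^ n ≤ (langN (betaFree d β) n).ncard := by
  have : NeZero d := ⟨by omega⟩
  have hd' : (3 : ℝ) ≤ d := by exact_mod_cast hd
  obtain ⟨m, hm⟩ := exists_forall_extendable_mem_langN (d := d) hβ n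
  refine le_of_forall_pow_le_mul_pow (C := {u : List (Fin d) | u.length = m}.ncard *
    (leftExtendable (Fin d) m m).ncard) (by positivity) fun k => ?_
  have h1 : (freeWords (Fin d) (m + (k * n + m))).ncard ≤
      {u : List (Fin d) | u.length = m}.ncard * (leftExtendable (Fin d) m m).ncard *
        (langN (betaFree d β) n).ncard ^ k :=
    (ncard_freeWords_le (Fin d) m (k * n + m)).trans
      ((Nat.mul_le_mul_left _ (ncard_leftExtendable_le hm k)).trans_eq (by ring))
  calc (((d : ℝ) - 1 / 2) ^ n) ^ k ≤ ((d : ℝ) - 1 / 2) ^ (m + (k * n + m)) := by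
        rw [← pow_mul]
        exact pow_le_pow_right₀ (by linarith) (by rw [mul_comm n k]; omega)
    _ ≤ (freeWords (Fin d) (m + (k * n + m))).ncard := pow_le_ncard_freeWords hd _
    _ ≤ _ := by exact_mod_cast h1

/-- For `d ≥ 3` and `β ≥ 8`, the entropy of `X^d_β` satisfies `e^{4h} ≥ d³ − 1`,
hence `h ≥ (1/4) log(d³ − 1) > 0`. -/
theorem entropy_lower_bound_beta_free (d : ℕ) (hd : 3 ≤ d) (β : ℝ) (hβ : 8 ≤ β) (h : ℝ)
    (hEnt : Tendsto (fun n : ℕ => Real.log ((langN (betaFree d β) n).ncard) / n)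
      atTop (nhds h)) :
    (d : ℝ) ^ 3 - 1 ≤ Real.exp (4 * h) ∧
    (1 / 4 : ℝ) * Real.log ((d : ℝ) ^ 3 - 1) ≤ h ∧ 0 < h := by
  have hd' : (3 : ℝ) ≤ d := by exact_mod_cast hd
  have hlog : Real.log ((d : ℝ) - 1 / 2) ≤ h := by
    refine ge_of_tendsto hEnt ?_
    filter_upwards [eventually_gt_atTop 0] with n hn
    have hn' : (0 : ℝ) < n := by exact_mod_cast hn
    rw [le_div_iff₀ hn', mul_comm, ← Real.log_pow]
    exact Real.log_le_log (pow_pos (by linarith) n) (pow_le_ncard_langN hd hβ n)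
  have hexp : (d : ℝ) ^ 3 - 1 ≤ Real.exp (4 * h) := by
    calc (d : ℝ) ^ 3 - 1 ≤ ((d : ℝ) - 1 / 2) ^ 4 := by
          obtain ⟨e, he, hde⟩ : ∃ e : ℝ, 0 ≤ e ∧ (d : ℝ) = e + 3 :=
            ⟨d - 3, by linarith, by ring⟩
          rw [hde]
          have : (0 : ℝ) ≤ e ^ 4 := by positivity
          have : (0 : ℝ) ≤ e ^ 3 := by positivity
          nlinarith [sq_nonneg e]
      _ = Real.exp (4 * Real.log ((d : ℝ) - 1 / 2)) := by
          rw [← Real.exp_log (show (0 : ℝ) < (d : ℝ) - 1 / 2 by linarith), Real.log_exp,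
            ← Real.exp_nat_mul]
          norm_num
      _ ≤ Real.exp (4 * h) := by gcongr
  have hpos : (1 : ℝ) < (d : ℝ) ^ 3 - 1 := by
    have : (3 : ℝ) ^ 3 ≤ (d : ℝ) ^ 3 := by gcongr
    linarith
  have hle : Real.log ((d : ℝ) ^ 3 - 1) ≤ 4 * h := by
    rw [Real.log_le_iff_le_exp (by linarith)]
    exact hexp
  exact ⟨hexp, by linarith, by linarith [Real.log_pos hpos]⟩
end

section
/- Let X be a shift space on a finite alphabet with language L and topological entropy h, satisfying e^{nh} ≤ #L_n ≤ C₂ e^{nh} for all n and some constant C₂. Then for every γ ∈ (0,1) there exists α > 0 (one may take α = (2C₂)^{−1/γ}) such that: whenever ν is a measure of maximal entropy on X, n ∈ ℕ, and D ⊆ L_n satisfies ν([D]) ≥ γ, we have #D ≥ α e^{nh}. -/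
open MeasureTheory Filter Real Set

/-- Pointwise Gibbs inequality. -/
lemma negMulLog_le_neg_mul_log_add_sub {p t : ℝ} (hp : 0 ≤ p) (ht : 0 ≤ t)
    (hpt : t = 0 → p = 0) :
    Real.negMulLog p ≤ -(p * Real.log t) + t - p := by
  rcases hp.eq_or_lt with rfl | hp
  · simpa using ht
  have ht : 0 < t := lt_of_le_of_ne ht fun h => hp.ne' (hpt h.symm)
  have h1 := Real.log_le_sub_one_of_pos (div_pos ht hp)
  rw [Real.log_div ht.ne' hp.ne'] at h1
  have h2 := mul_le_mul_of_nonneg_left h1 hp.le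
  have h3 : p * (t / p - 1) = t - p := by field_simp
  rw [h3] at h2
  unfold Real.negMulLog
  linarith

/-- Subadditivity of Shannon entropy for a joint distribution on a finite product. -/
lemma sum_negMulLog_le_add_marginals {α β : Type*} [Fintype α] [Fintype β]
    (p : α → β → ℝ) (hp : ∀ a b, 0 ≤ p a b) (hsum : ∑ a, ∑ b, p a b = 1) :
    ∑ a, ∑ b, Real.negMulLog (p a b) ≤
      ∑ a, Real.negMulLog (∑ b, p a b) + ∑ b, Real.negMulLog (∑ a, p a b) := by
  set q : α → ℝ := fun a => ∑ b, p a b with hq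
  set r : β → ℝ := fun b => ∑ a, p a b with hr
  have hpq : ∀ a b, p a b ≤ q a := fun a b =>
    Finset.single_le_sum (f := fun b => p a b) (fun b _ => hp a b) (Finset.mem_univ b)
  have hpr : ∀ a b, p a b ≤ r b := fun a b =>
    Finset.single_le_sum (f := fun a => p a b) (fun a _ => hp a b) (Finset.mem_univ a)
  have hq1 : ∑ a, q a = 1 := hsum
  have hr1 : ∑ b, r b = 1 := by rw [← hsum, Finset.sum_comm]
  have key : ∀ a b, Real.negMulLog (p a b) ≤
      -(p a b * Real.log (q a)) - p a b * Real.log (r b) + q a * r b - p a b := by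
    intro a b
    have hq0 : 0 ≤ q a := (hp a b).trans (hpq a b)
    have hr0 : 0 ≤ r b := (hp a b).trans (hpr a b)
    rcases (hp a b).eq_or_lt with h0 | h0
    · simpa [← h0] using mul_nonneg hq0 hr0
    · have hq' := (h0.trans_le (hpq a b)).ne'
      have hr' := (h0.trans_le (hpr a b)).ne'
      have := negMulLog_le_neg_mul_log_add_sub (hp a b) (mul_nonneg hq0 hr0)
        fun h => absurd h (mul_ne_zero hq' hr')
      rw [Real.log_mul hq' hr'] at this
      linarith
  have hsum' : ∑ a, ∑ b, p a b = 1 := hsum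
  have e1 : ∑ a, ∑ b, p a b * Real.log (q a) = ∑ a, q a * Real.log (q a) := by
    simp_rw [← Finset.sum_mul]; rfl
  have e2 : ∑ a, ∑ b, p a b * Real.log (r b) = ∑ b, r b * Real.log (r b) := by
    rw [Finset.sum_comm]; simp_rw [← Finset.sum_mul]; rfl
  have e3 : ∑ a, ∑ b, q a * r b = 1 := by
    rw [← Finset.sum_mul_sum, hq1, hr1, one_mul]
  calc ∑ a, ∑ b, Real.negMulLog (p a b)
      ≤ ∑ a, ∑ b, (-(p a b * Real.log (q a)) - p a b * Real.log (r b)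
          + q a * r b - p a b) :=
        Finset.sum_le_sum fun a _ => Finset.sum_le_sum fun b _ => key a b
    _ = ∑ a, Real.negMulLog (q a) + ∑ b, Real.negMulLog (r b) := by
        simp only [Finset.sum_sub_distrib, Finset.sum_add_distrib, Finset.sum_neg_distrib,
          e1, e2, e3, hsum', Real.negMulLog, neg_mul]
        ring

/-- If a probability vector is supported on `L`, then its entropy is at most the cross entropy
with the equal mixture of the uniform distributions on `D` and on `L`. -/
lemma sum_negMulLog_le_of_support {α : Type*} [Fintype α] [DecidableEq α]
    (p : α → ℝ) (hp : ∀ a, 0 ≤ p a) (hsum : ∑ a, p a = 1) (L D : Finset α)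
    (hD : D.Nonempty) (hDL : D ⊆ L) (hL : ∀ a, a ∉ L → p a = 0) :
    ∑ a, Real.negMulLog (p a) ≤ Real.log 2 + (∑ a ∈ D, p a) * Real.log D.card +
      (1 - ∑ a ∈ D, p a) * Real.log L.card := by
  have hD0 : (0 : ℝ) < D.card := by exact_mod_cast hD.card_pos
  have hL0 : (0 : ℝ) < L.card := by exact_mod_cast (hD.mono hDL).card_pos
  have hLsum : ∑ a ∈ L, p a = 1 := by
    rw [← hsum]
    exact Finset.sum_subset (Finset.subset_univ L) fun a _ ha => hL a ha
  have hdiff : ∑ a ∈ L \ D, p a = 1 - ∑ a ∈ D, p a := by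
    rw [← hLsum, ← Finset.sum_sdiff hDL]; ring
  have bound : ∀ (S : Finset α) (c : ℝ), 0 < c → (S.card : ℝ) ≤ c →
      ∑ a ∈ S, Real.negMulLog (p a) ≤
        (∑ a ∈ S, p a) * (Real.log 2 + Real.log c) + 1 / 2 - ∑ a ∈ S, p a := by
    intro S c hc hSc
    have : ∀ a ∈ S, Real.negMulLog (p a) ≤
        p a * (Real.log 2 + Real.log c) + (2 * c)⁻¹ - p a := by
      intro a _
      have := negMulLog_le_neg_mul_log_add_sub (hp a) (t := (2 * c)⁻¹) (by positivity)
        fun h => absurd h (by positivity)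
      rw [Real.log_inv, Real.log_mul two_ne_zero hc.ne'] at this
      linarith
    refine (Finset.sum_le_sum this).trans ?_
    rw [Finset.sum_sub_distrib, Finset.sum_add_distrib, ← Finset.sum_mul, Finset.sum_const,
      nsmul_eq_mul]
    have : (S.card : ℝ) * (2 * c)⁻¹ ≤ 1 / 2 := by
      rw [← div_eq_mul_inv, div_le_div_iff₀ (by positivity) two_pos]
      linarith
    linarith
  have hsplit : ∑ a, Real.negMulLog (p a) =
      ∑ a ∈ L \ D, Real.negMulLog (p a) + ∑ a ∈ D, Real.negMulLog (p a) := by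
    rw [Finset.sum_sdiff hDL]
    exact (Finset.sum_subset (Finset.subset_univ L) fun a _ ha => by simp [hL a ha]).symm
  have b1 := bound D D.card hD0 le_rfl
  have b2 := bound (L \ D) L.card hL0
    (by exact_mod_cast Finset.card_le_card Finset.sdiff_subset)
  rw [hdiff] at b2
  rw [hsplit]
  linarith

lemma iterate_shift_apply {A : Type*} (m : ℕ) (x : ℤ → A) (k : ℤ) :
    shift^[m] x k = x (k + m) := by
  induction m generalizing x with
  | zero => simp
  | succ m ih =>
    rw [Function.iterate_succ_apply, ih]
    simp only [shift]
    congr 1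
    push_cast
    ring

lemma measurable_shift {A : Type*} [MeasurableSpace A] :
    Measurable (shift : (ℤ → A) → ℤ → A) :=
  measurable_pi_lambda _ fun n => measurable_pi_apply (n + 1)

lemma IsShiftInvariant.measure_preimage_iterate {A : Type*} [MeasurableSpace A]
    {μ : Measure (ℤ → A)} (hμ : IsShiftInvariant μ) (m : ℕ) {E : Set (ℤ → A)}
    (hE : MeasurableSet E) : μ (shift^[m] ⁻¹' E) = μ E := by
  induction m with
  | zero => rfl
  | succ m ih =>
    rw [Function.iterate_succ, preimage_comp, hμ _ ((measurable_shift.iterate m) hE), ih]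

lemma cylinder_ofFn {A : Type*} {n : ℕ} (w : Fin n → A) :
    cylinder (List.ofFn w) = (fun (x : ℤ → A) (t : Fin n) => x (t : ℤ)) ⁻¹' {w} := by
  ext x
  simp only [_root_.cylinder, mem_ofPred_eq, mem_preimage, mem_singleton_iff, funext_iff,
    List.length_ofFn, List.getElem_ofFn]
  exact ⟨fun hx t => hx t t.2, fun hx t ht => hx ⟨t, ht⟩⟩

lemma measurableSet_cylinder_ofFn {A : Type*} [MeasurableSpace A] [MeasurableSingletonClass A]
    {n : ℕ} (w : Fin n → A) : MeasurableSet (cylinder (List.ofFn w)) := by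
  rw [cylinder_ofFn]
  exact (measurable_pi_lambda _ fun t => measurable_pi_apply _) (measurableSet_singleton w)

lemma cylinder_ofFn_append {A : Type*} {m n : ℕ} (u : Fin m → A) (v : Fin n → A) :
    cylinder (List.ofFn (Fin.append u v)) =
      cylinder (List.ofFn u) ∩ shift^[m] ⁻¹' cylinder (List.ofFn v) := by
  ext x
  simp only [cylinder_ofFn, mem_inter_iff, mem_preimage, mem_singleton_iff, funext_iff,
    iterate_shift_apply, Fin.forall_fin_add, Fin.append_left, Fin.append_right, Fin.val_castAdd,
    Fin.val_natAdd, Nat.cast_add, add_comm]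

lemma sum_measureReal_inter_preimage_cylinder {A : Type*} [Fintype A] [MeasurableSpace A]
    [MeasurableSingletonClass A] (μ : Measure (ℤ → A)) [IsFiniteMeasure μ] (n : ℕ)
    (E : Set (ℤ → A)) {f : (ℤ → A) → ℤ → A} (hf : Measurable f) :
    ∑ w : Fin n → A, μ.real (E ∩ f ⁻¹' cylinder (List.ofFn w)) = μ.real E := by
  have hm : ∀ w : Fin n → A, MeasurableSet (f ⁻¹' cylinder (List.ofFn w)) :=
    fun w => hf (measurableSet_cylinder_ofFn w)
  have h1 : ∀ w : Fin n → A, μ.real (E ∩ f ⁻¹' cylinder (List.ofFn w)) =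
      (μ.restrict E).real
        ((fun x (t : Fin n) => f x (t : ℤ)) ⁻¹' {w}) := by
    intro w
    rw [inter_comm, ← measureReal_restrict_apply (hm w), cylinder_ofFn]
    rfl
  simp_rw [h1]
  rw [sum_measureReal_preimage_singleton]
  · simp
  · intro w _
    have := hm w
    rw [cylinder_ofFn] at this
    exact this

lemma sum_measureReal_cylinder {A : Type*} [Fintype A] [MeasurableSpace A]
    [MeasurableSingletonClass A] (μ : Measure (ℤ → A)) [IsProbabilityMeasure μ] (n : ℕ) :
    ∑ w : Fin n → A, μ.real (cylinder (List.ofFn w)) = 1 := by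
  simpa using sum_measureReal_inter_preimage_cylinder μ n univ measurable_id

lemma IsShiftInvariant.subadditive_cylEntropySum {A : Type*} [Fintype A] [MeasurableSpace A]
    [MeasurableSingletonClass A] {μ : Measure (ℤ → A)} [IsProbabilityMeasure μ]
    (hμ : IsShiftInvariant μ) : Subadditive (cylEntropySum μ) := by
  intro m n
  set p : (Fin m → A) → (Fin n → A) → ℝ := fun u v =>
    μ.real (cylinder (List.ofFn u) ∩ shift^[m] ⁻¹' cylinder (List.ofFn v)) with hp
  have hq : ∀ u, ∑ v, p u v = μ.real (cylinder (List.ofFn u)) := fun u =>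
    sum_measureReal_inter_preimage_cylinder μ n _ (measurable_shift.iterate m)
  have hr : ∀ v, ∑ u, p u v = μ.real (cylinder (List.ofFn v)) := by
    intro v
    have := sum_measureReal_inter_preimage_cylinder μ m
      (shift^[m] ⁻¹' cylinder (List.ofFn v)) measurable_id
    simp only [preimage_id] at this
    simp only [hp, inter_comm (cylinder _)]
    rw [this, Measure.real, hμ.measure_preimage_iterate m (measurableSet_cylinder_ofFn v),
      Measure.real]
  have hsum : ∑ u, ∑ v, p u v = 1 := by simp_rw [hq, sum_measureReal_cylinder]
  have := sum_negMulLog_le_add_marginals p (fun _ _ => measureReal_nonneg) hsum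
  simp_rw [hq, hr] at this
  refine le_trans (le_of_eq ?_) this
  rw [cylEntropySum, ← (Fin.appendEquiv m n).sum_comp, Fintype.sum_prod_type]
  refine Finset.sum_congr rfl fun u _ => Finset.sum_congr rfl fun v _ => ?_
  rw [← Measure.real]
  exact congrArg (fun s => Real.negMulLog (μ.real s)) (cylinder_ofFn_append u v)

lemma cylEntropySum_nonneg {A : Type*} [Fintype A] [MeasurableSpace A]
    (μ : Measure (ℤ → A)) [IsProbabilityMeasure μ] (n : ℕ) : 0 ≤ cylEntropySum μ n :=
  Finset.sum_nonneg fun _ _ => Real.negMulLog_nonneg measureReal_nonneg measureReal_le_one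

lemma IsMME.mul_le_cylEntropySum {A : Type*} [Fintype A] [MeasurableSpace A]
    [MeasurableSingletonClass A] {X : Set (ℤ → A)} {h : ℝ} {μ : Measure (ℤ → A)}
    (hμ : IsMME X h μ) (n : ℕ) : n * h ≤ cylEntropySum μ n := by
  obtain ⟨hprob, -, hinv, hlim⟩ := hμ
  rcases n.eq_zero_or_pos with rfl | hn
  · simpa using cylEntropySum_nonneg μ 0
  have hbdd : BddBelow (range fun n : ℕ => cylEntropySum μ n / n) :=
    ⟨0, by rintro _ ⟨k, rfl⟩; exact div_nonneg (cylEntropySum_nonneg μ k) k.cast_nonneg⟩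
  have hsub := hinv.subadditive_cylEntropySum
  have heq : hsub.lim = h := tendsto_nhds_unique (hsub.tendsto_lim hbdd) hlim
  have := hsub.lim_le_div hbdd hn.ne'
  rw [heq, le_div_iff₀ (by exact_mod_cast hn)] at this
  linarith

lemma measure_cylinder_eq_zero_of_notMem_language {A : Type*} [MeasurableSpace A]
    [MeasurableSingletonClass A] {X : Set (ℤ → A)} {μ : Measure (ℤ → A)}
    [IsProbabilityMeasure μ] (hX : μ X = 1) {n : ℕ} {w : Fin n → A}
    (hw : List.ofFn w ∉ language X) : μ (cylinder (List.ofFn w)) = 0 := by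
  rw [← prob_compl_eq_one_iff (measurableSet_cylinder_ofFn w)]
  refine le_antisymm prob_le_one (hX ▸ measure_mono fun x hx hxw => hw ⟨x, hx, 0, ?_⟩)
  intro t ht
  rw [zero_add]
  exact hxw t ht

lemma card_filter_ofFn_mem {A : Type*} [Fintype A] {n : ℕ} {S : Set (List A)}
    [DecidablePred fun w : Fin n → A => List.ofFn w ∈ S] (hS : ∀ w ∈ S, w.length = n) :
    (Finset.univ.filter fun w : Fin n → A => List.ofFn w ∈ S).card = S.ncard := by
  rw [← ncard_coe_finset, ← ncard_image_of_injective _ (List.ofFn_injective (n := n))]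
  congr 1
  ext w
  simp only [Finset.coe_filter, Finset.mem_univ, true_and, mem_image, mem_ofPred_eq]
  refine ⟨?_, fun hw => ?_⟩
  · rintro ⟨v, hv, rfl⟩
    exact hv
  · obtain rfl := hS w hw
    exact ⟨w.get, by simpa using hw, by simp⟩

/-- Uniform Katok-type counting bound: any collection of cylinders carrying
`ν`-measure at least `γ` for an MME `ν` must have cardinality at least
`α e^{nh}`, with `α = (2C₂)^{−1/γ}`. -/
theorem card_lower_bound_of_mme_measure {A : Type*} [Fintype A]
    [TopologicalSpace A] [DiscreteTopology A] [MeasurableSpace A] [BorelSpace A]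
    (X : Set (ℤ → A)) (hX : IsShiftSpace X) (h : ℝ)
    (hEnt : Tendsto (fun n : ℕ => Real.log ((langN X n).ncard) / n) atTop (nhds h))
    (C₂ : ℝ)
    (hbounds : ∀ n : ℕ, 1 ≤ n →
      Real.exp (n * h) ≤ ((langN X n).ncard : ℝ) ∧
      ((langN X n).ncard : ℝ) ≤ C₂ * Real.exp (n * h)) :
    ∀ γ : ℝ, 0 < γ → γ < 1 →
      ∃ α : ℝ, 0 < α ∧ α = (2 * C₂) ^ (-(1 / γ)) ∧
        ∀ ν : Measure (ℤ → A), IsMME X h ν →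
          ∀ n : ℕ, ∀ D : Set (List A), D ⊆ langN X n →
            ENNReal.ofReal γ ≤ ν (⋃ w ∈ D, cylinder w) →
            α * Real.exp (n * h) ≤ (D.ncard : ℝ) := by
  classical
  intro γ hγ _
  have hC : 1 ≤ C₂ := by
    have h1 := (hbounds 1 le_rfl).1.trans (hbounds 1 le_rfl).2
    exact le_of_mul_le_mul_right (by linarith) (Real.exp_pos ((1 : ℕ) * h))
  have hL : ∀ n : ℕ, ((langN X n).ncard : ℝ) ≤ C₂ * Real.exp (n * h) := by
    intro n
    rcases n.eq_zero_or_pos with rfl | hn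
    · have : (langN X 0).ncard ≤ 1 := by
        rw [← ncard_singleton ([] : List A)]
        exact ncard_le_ncard fun w hw => List.length_eq_zero_iff.1 hw.2
      have : ((langN X 0).ncard : ℝ) ≤ 1 := by exact_mod_cast this
      simpa using this.trans hC
    · exact (hbounds n hn).2
  have h2C : 0 < 2 * C₂ := by linarith
  refine ⟨(2 * C₂) ^ (-(1 / γ)), Real.rpow_pos_of_pos h2C _, rfl, fun ν hν n D hD hνD => ?_⟩
  have hent := hν.mul_le_cylEntropySum n
  obtain ⟨hprob, hνX, -, -⟩ := hν
  set p : (Fin n → A) → ℝ := fun w => ν.real (cylinder (List.ofFn w)) with hp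
  set D' := Finset.univ.filter fun w : Fin n → A => List.ofFn w ∈ D with hD'
  set L' := Finset.univ.filter fun w : Fin n → A => List.ofFn w ∈ langN X n with hL'
  have hDcard : D'.card = D.ncard := card_filter_ofFn_mem fun w hw => (hD hw).2
  have hLcard : L'.card = (langN X n).ncard := card_filter_ofFn_mem fun w hw => hw.2
  have hDL : D' ⊆ L' := Finset.monotone_filter_right _ fun w _ hw => hD hw
  have hγD : γ ≤ ∑ w ∈ D', p w := by
    have hsub : (⋃ w ∈ D, cylinder w) ⊆ ⋃ w ∈ D', cylinder (List.ofFn w) := by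
      refine iUnion₂_subset fun w hw => ?_
      obtain rfl : w.length = n := (hD hw).2
      have hmem : w.get ∈ D' := by simpa [hD'] using hw
      have := subset_biUnion_of_mem (s := (D' : Set (Fin w.length → A)))
        (u := fun v => cylinder (List.ofFn v)) hmem
      simpa only [List.ofFn_get, Finset.mem_coe] using this
    have h1 : γ ≤ ν.real (⋃ w ∈ D, cylinder w) :=
      (ENNReal.ofReal_le_iff_le_toReal (measure_ne_top ν _)).1 hνD
    exact h1.trans ((measureReal_mono hsub (measure_ne_top ν _)).trans (measureReal_biUnion_finset_le D' _))
  have hDne : D'.Nonempty := by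
    rw [Finset.nonempty_iff_ne_empty]
    intro h0
    rw [h0, Finset.sum_empty] at hγD
    linarith
  have hsum : ∑ w, p w = 1 := sum_measureReal_cylinder ν n
  have hsupp : ∀ w, w ∉ L' → p w = 0 := by
    intro w hw
    have : List.ofFn w ∉ language X := fun hl => hw (by simp [hL', langN, hl])
    simp [hp, Measure.real, measure_cylinder_eq_zero_of_notMem_language hνX this]
  have hub := sum_negMulLog_le_of_support p (fun _ => measureReal_nonneg) hsum L' D' hDne hDL hsupp
  set s := ∑ w ∈ D', p w with hs
  have hs1 : s ≤ 1 := by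
    rw [← hsum]
    exact Finset.sum_le_sum_of_subset_of_nonneg (Finset.subset_univ _)
      fun _ _ _ => measureReal_nonneg
  have hlogL : Real.log L'.card ≤ Real.log C₂ + n * h := by
    rw [← Real.log_exp (n * h), ← Real.log_mul (by linarith) (Real.exp_pos _).ne', hLcard]
    refine Real.log_le_log ?_ (hL n)
    rw [← hLcard]
    exact_mod_cast (hDne.mono hDL).card_pos
  have hlogC : 0 ≤ Real.log C₂ := Real.log_nonneg hC
  have hlog2 : 0 ≤ Real.log 2 := Real.log_nonneg one_le_two
  have hs0 : 0 < s := hγ.trans_le hγD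
  have hmain : s * (n * h - Real.log D'.card) ≤ Real.log (2 * C₂) := by
    have h1 := mul_le_mul_of_nonneg_left hlogL (sub_nonneg.2 hs1)
    have h2 := hent.trans hub
    have h3 := mul_nonneg hs0.le hlogC
    rw [Real.log_mul two_ne_zero (by linarith)]
    linarith
  have hfinal : n * h - Real.log D'.card ≤ Real.log (2 * C₂) / γ := by
    have h1 : n * h - Real.log D'.card ≤ Real.log (2 * C₂) / s := by
      rw [le_div_iff₀ hs0]
      linarith
    exact h1.trans (div_le_div_of_nonneg_left (Real.log_nonneg (by linarith)) hγ hγD)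
  have hD0 : (0 : ℝ) < D'.card := by exact_mod_cast hDne.card_pos
  rw [← hDcard, ← Real.exp_log hD0, Real.rpow_def_of_pos h2C, ← Real.exp_add]
  refine Real.exp_le_exp.2 ?_
  have : Real.log (2 * C₂) * -(1 / γ) = -(Real.log (2 * C₂) / γ) := by ring
  linarith
end
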